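/- Let T and A be independent real-valued random variables on a probability space (Ω, ℙ), with T ≥ 0 almost surely, and let W > 0. Then ℙ(E) = ∫_{[0,W]} (F_A(W) − F_A(t)) dμ_T(t) + F_T(W) · (1 − F_A(W)), where E = {T ≤ W} ∩ {T < A} is the home-early event, F_T and F_A are the cumulative distribution functions of T and A, and μ_T is the law of T. -/

import Mathlib

open MeasureTheory ProbabilityTheory

/-- For independent `X` and `Y`, the event `{X ∈ s} ∩ {X < Y}` is computed by conditioning
on the value of `X`. -/
theorem measure_preimage_inter_lt_eq_setLIntegral {Ω : Type*} [MeasurableSpace Ω]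
    {P : Measure Ω} [IsFiniteMeasure P] {X Y : Ω → ℝ} (hX : Measurable X) (hY : Measurable Y)
    (hXY : IndepFun X Y P) {s : Set ℝ} (hs : MeasurableSet s) :
    P (X ⁻¹' s ∩ {ω | X ω < Y ω}) = ∫⁻ x in s, P {ω | x < Y ω} ∂(P.map X) := by
  have hlt : MeasurableSet {p : ℝ × ℝ | p.1 < p.2} := measurableSet_lt measurable_fst measurable_snd
  have hmeas : MeasurableSet (Prod.fst ⁻¹' s ∩ {p : ℝ × ℝ | p.1 < p.2}) :=
    (measurable_fst hs).inter hlt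
  calc P (X ⁻¹' s ∩ {ω | X ω < Y ω})
      = P.map (fun ω => (X ω, Y ω)) (Prod.fst ⁻¹' s ∩ {p : ℝ × ℝ | p.1 < p.2}) :=
        (Measure.map_apply (hX.prodMk hY) hmeas).symm
    _ = ∫⁻ x, s.indicator (fun x => P {ω | x < Y ω}) x ∂(P.map X) := by
        rw [(indepFun_iff_map_prod_eq_prod_map_map hX.aemeasurable hY.aemeasurable).1 hXY,
          Measure.prod_apply hmeas]
        refine lintegral_congr fun x => ?_
        rw [Measure.map_apply hY (measurable_prodMk_left hmeas)]
        by_cases hx : x ∈ s <;> simp [Set.preimage, Set.inter_def, hx]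
    _ = ∫⁻ x in s, P {ω | x < Y ω} ∂(P.map X) := lintegral_indicator hs _

/-- For independent real random variables `T, A` on a probability space,
with `T ≥ 0` a.s. and `W > 0`, the probability of the home-early event
`E = {T ≤ W} ∩ {T < A}` satisfies
`P(E) = ∫_{[0,W]} (F_A(W) − F_A(t)) dμ_T(t) + F_T(W) · (1 − F_A(W))`,
where `F_T(x) = P(T ≤ x)`, `F_A(x) = P(A ≤ x)` are the CDFs of `T` and `A`,
and `μ_T = Measure.map T P` is the law of `T`. -/
theorem home_early_prob_eq_cdf_integral {Ω : Type*} [MeasurableSpace Ω] (P : Measure Ω)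
    [IsProbabilityMeasure P] (T A : Ω → ℝ) (hT : Measurable T) (hA : Measurable A)
    (hInd : IndepFun T A P) (hT0 : ∀ᵐ ω ∂P, 0 ≤ T ω) (W : ℝ) (hW : 0 < W) :
    P ({ω | T ω ≤ W} ∩ {ω | T ω < A ω}) =
      (∫⁻ t in Set.Icc 0 W, (P {ω | A ω ≤ W} - P {ω | A ω ≤ t}) ∂(Measure.map T P)) +
        P {ω | T ω ≤ W} * (1 - P {ω | A ω ≤ W}) := by
  have hmap : ∀ᵐ t ∂(P.map T), 0 ≤ t :=
    (ae_map_iff hT.aemeasurable measurableSet_Ici).2 hT0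
  have hIcc : (Set.Iic W : Set ℝ) =ᵐ[P.map T] Set.Icc 0 W := by
    filter_upwards [hmap] with t ht
    exact propext ⟨fun h => ⟨ht, h⟩, fun h => h.2⟩
  have hsplit : ∀ t ∈ Set.Icc 0 W, P {ω | t < A ω} =
      (P {ω | A ω ≤ W} - P {ω | A ω ≤ t}) + (1 - P {ω | A ω ≤ W}) := by
    intro t ht
    have hle : P {ω | A ω ≤ t} ≤ P {ω | A ω ≤ W} :=
      measure_mono fun ω (hω : A ω ≤ t) => hω.trans ht.2
    have hcompl : {ω | t < A ω} = {ω | A ω ≤ t}ᶜ := by ext; simp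
    rw [hcompl, prob_compl_eq_one_sub (measurableSet_le hA measurable_const), add_comm,
      tsub_add_tsub_cancel prob_le_one hle]
  have hTW : P.map T (Set.Icc 0 W) = P {ω | T ω ≤ W} := by
    rw [← measure_congr hIcc, Measure.map_apply hT measurableSet_Iic]
    rfl
  calc P ({ω | T ω ≤ W} ∩ {ω | T ω < A ω})
      = ∫⁻ t in Set.Iic W, P {ω | t < A ω} ∂(P.map T) :=
        measure_preimage_inter_lt_eq_setLIntegral hT hA hInd measurableSet_Iic
    _ = ∫⁻ t in Set.Icc 0 W,
          ((P {ω | A ω ≤ W} - P {ω | A ω ≤ t}) + (1 - P {ω | A ω ≤ W})) ∂(P.map T) := by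
        rw [setLIntegral_congr hIcc]
        exact setLIntegral_congr_fun measurableSet_Icc hsplit
    _ = _ := by
        rw [lintegral_add_right _ measurable_const, setLIntegral_const, hTW, mul_comm]
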